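/- Let S and T be pseudogroups and suppose there exists an (S,T)-equivalence bimodule. Then S and T have a joint sup-enlargement: there exists a pseudogroup U and idempotents 𝐞_S, 𝐞_T ∈ E(U) such that 𝐞_S U 𝐞_S ≅ S, 𝐞_T U 𝐞_T ≅ T, and U is a sup-enlargement of both local pseudogroups. (Concretely, U may be taken to be the set of 2×2 matrices (s, x; ȳ, t) with s ∈ S, t ∈ T, x, y ∈ X subject to the generalized rook conditions s⁻¹x = 0, yt = 0, sy = 0, xt⁻¹ = 0, with the matrix-style multiplication using joins and the inner products.) -/

import Mathlib

namespace PseudogroupMorita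

/-- An inverse semigroup: a semigroup in which every element `a` has a unique
inverse `a⁻¹` satisfying `a * a⁻¹ * a = a` and `a⁻¹ * a * a⁻¹ = a⁻¹`. -/
class InverseSemigroup (S : Type*) extends Semigroup S, Inv S where
  mul_inv_mul : ∀ a : S, a * a⁻¹ * a = a
  inv_mul_inv : ∀ a : S, a⁻¹ * a * a⁻¹ = a⁻¹
  inv_unique : ∀ a b : S, a * b * a = a → b * a * b = b → b = a⁻¹

/-- `a` is an idempotent. -/
def IsIdem {S : Type*} [Mul S] (a : S) : Prop := a * a = a

/-- The natural partial order: `a ≤ b` iff `a = e * b` for some idempotent `e`. -/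
def nle {S : Type*} [Mul S] (a b : S) : Prop := ∃ e : S, IsIdem e ∧ a = e * b

/-- `s` and `t` are left compatible: `s⁻¹ * t` is an idempotent. -/
def LeftCompat {S : Type*} [Mul S] [Inv S] (s t : S) : Prop := IsIdem (s⁻¹ * t)

/-- `s` and `t` are right compatible: `s * t⁻¹` is an idempotent. -/
def RightCompat {S : Type*} [Mul S] [Inv S] (s t : S) : Prop := IsIdem (s * t⁻¹)

/-- `s` and `t` are compatible. -/
def Compat {S : Type*} [Mul S] [Inv S] (s t : S) : Prop := LeftCompat s t ∧ RightCompat s t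

/-- A compatible subset: any two of its elements are compatible. -/
def CompatSet {S : Type*} [Mul S] [Inv S] (A : Set S) : Prop := ∀ a ∈ A, ∀ b ∈ A, Compat a b

/-- `j` is the join (least upper bound) of `A` with respect to the natural partial order. -/
def IsJoin {S : Type*} [Mul S] (A : Set S) (j : S) : Prop :=
  (∀ a ∈ A, nle a j) ∧ ∀ b : S, (∀ a ∈ A, nle a b) → nle j b

/-- A pseudogroup: an inverse semigroup in which every compatible subset has a join
and multiplication distributes over such joins. -/
class Pseudogroup (S : Type*) extends InverseSemigroup S where
  joins_exist : ∀ A : Set S, CompatSet A → ∃ j : S, IsJoin A j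
  mul_join_left : ∀ (s : S) (A : Set S) (j : S), CompatSet A → IsJoin A j →
    IsJoin ((fun a => s * a) '' A) (s * j)
  mul_join_right : ∀ (s : S) (A : Set S) (j : S), CompatSet A → IsJoin A j →
    IsJoin ((fun a => a * s) '' A) (j * s)

/-- `A^∨`: the set of all joins of compatible subsets of `A`. -/
def supClosure {S : Type*} [Mul S] [Inv S] (A : Set S) : Set S :=
  {j | ∃ C : Set S, C ⊆ A ∧ CompatSet C ∧ IsJoin C j}

/-- The underlying set of the local semigroup `eSe`. -/
def locSet {S : Type*} [Mul S] (e : S) : Set S := {u : S | u = e * u * e}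

/-- The set `A * B * C` of triple products. -/
def tripleProd {S : Type*} [Mul S] (A B C : Set S) : Set S :=
  {x : S | ∃ a ∈ A, ∃ b ∈ B, ∃ c ∈ C, x = a * b * c}

/-- A (two-sided) semigroup ideal. -/
def SemigroupIdeal {S : Type*} [Mul S] (I : Set S) : Prop :=
  ∀ s : S, ∀ a ∈ I, s * a ∈ I ∧ a * s ∈ I

/-- A sup-ideal: an ideal closed under arbitrary compatible joins. -/
def IsSupIdeal {S : Type*} [Mul S] [Inv S] (I : Set S) : Prop :=
  SemigroupIdeal I ∧ ∀ C : Set S, C ⊆ I → CompatSet C → ∀ j : S, IsJoin C j → j ∈ I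

/-- A pencil from `e` to `f`: a subset `X` with `e = ⋁_{x ∈ X} d x` and `f ≥ ⋁_{x ∈ X} r x`. -/
def IsPencil {S : Type*} [Mul S] [Inv S] (X : Set S) (e f : S) : Prop :=
  IsJoin ((fun x => x⁻¹ * x) '' X) e ∧
  ∃ j : S, IsJoin ((fun x => x * x⁻¹) '' X) j ∧ nle j f

/-- `e ⪯ f` iff there is a pencil from `e` to `f`. -/
def PencilLE {S : Type*} [Mul S] [Inv S] (e f : S) : Prop := ∃ X : Set S, IsPencil X e f

/-- A sup-ideal of the (local) pseudogroup whose underlying set is `A`. -/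
def IsSupIdealIn {S : Type*} [Mul S] [Inv S] (A I : Set S) : Prop :=
  I ⊆ A ∧ (∀ s ∈ A, ∀ a ∈ I, s * a ∈ I ∧ a * s ∈ I) ∧
  ∀ C : Set S, C ⊆ I → CompatSet C → ∀ j : S, IsJoin C j → j ∈ I

/-- The (local) pseudogroup with underlying set `A` and least element `z` is 0-simplifying:
its only sup-ideals are `{z}` and `A` itself. -/
def ZeroSimplifyingIn {S : Type*} [Mul S] [Inv S] (A : Set S) (z : S) : Prop :=
  ∀ I : Set S, IsSupIdealIn A I → I = {z} ∨ I = A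

/-- The (local) inverse semigroup with underlying set `A` is fundamental: any of its
elements commuting with all of its idempotents is an idempotent. -/
def FundamentalIn {S : Type*} [Mul S] (A : Set S) : Prop :=
  ∀ a ∈ A, (∀ g ∈ A, IsIdem g → a * g = g * a) → IsIdem a

/-- A supported left action of an inverse semigroup `S` on a set `X`. -/
structure SupportedAction (S : Type*) [InverseSemigroup S] (X : Type*) where
  act : S → X → X
  act_mul : ∀ (s t : S) (x : X), act (s * t) x = act s (act t x)
  p : X → S
  p_idem : ∀ x : X, IsIdem (p x)
  p_act : ∀ x : X, act (p x) x = x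
  p_conj : ∀ (s : S) (x : X), p (act s x) = s * p x * s⁻¹

namespace SupportedAction

variable {S : Type*} [InverseSemigroup S] {X Y : Type*}

/-- `x` and `y` are left compatible: `p(x) y = p(y) x`. -/
def LCompat (M : SupportedAction S X) (x y : X) : Prop :=
  M.act (M.p x) y = M.act (M.p y) x

/-- A left compatible subset of `X`. -/
def LCompatSet (M : SupportedAction S X) (A : Set X) : Prop :=
  ∀ x ∈ A, ∀ y ∈ A, M.LCompat x y

/-- The order on `X`: `x ≤ y` iff `x = e • y` for some idempotent `e`. -/
def xle (M : SupportedAction S X) (x y : X) : Prop :=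
  ∃ e : S, IsIdem e ∧ x = M.act e y

/-- `j` is the join of `A ⊆ X`. -/
def IsJoinX (M : SupportedAction S X) (A : Set X) (j : X) : Prop :=
  (∀ a ∈ A, M.xle a j) ∧ ∀ b : X, (∀ a ∈ A, M.xle a b) → M.xle j b

/-- `m` is the (binary) meet of `x` and `y` in `X`. -/
def IsMeetX (M : SupportedAction S X) (x y m : X) : Prop :=
  M.xle m x ∧ M.xle m y ∧ ∀ z : X, M.xle z x → M.xle z y → M.xle z m

/-- The action is pointed, with minimum `z ∈ X` and `zS` the least element of `S`:
`s • z = z` and `zS • x = z`. -/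
def Pointed (M : SupportedAction S X) (z : X) (zS : S) : Prop :=
  (∀ x : X, M.xle z x) ∧ (∀ s : S, M.act s z = z) ∧ (∀ x : X, M.act zS x = z)

/-- A homomorphism of supported left `S`-actions. -/
def IsActHom (M : SupportedAction S X) (N : SupportedAction S Y) (θ : X → Y) : Prop :=
  (∀ (s : S) (x : X), θ (M.act s x) = N.act s (θ x)) ∧ ∀ x : X, N.p (θ x) = M.p x

end SupportedAction

/-- A left `S`-module over a pseudogroup `S`: a supported left action such that every
left compatible subset of `X` has a join, the action distributes over left compatible
joins, and joins of compatible subsets of `S` act as joins. -/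
structure SMod (S : Type*) [Pseudogroup S] (X : Type*) extends SupportedAction S X where
  joinsX : ∀ A : Set X, toSupportedAction.LCompatSet A → ∃ j : X, toSupportedAction.IsJoinX A j
  act_joinX : ∀ (s : S) (A : Set X) (j : X), toSupportedAction.LCompatSet A →
    toSupportedAction.IsJoinX A j →
    toSupportedAction.IsJoinX (toSupportedAction.act s '' A) (toSupportedAction.act s j)
  join_act : ∀ (A : Set S) (j : S), CompatSet A → IsJoin A j → ∀ x : X,
    toSupportedAction.IsJoinX ((fun s => toSupportedAction.act s x) '' A)
      (toSupportedAction.act j x)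

/-- A homomorphism of left `S`-modules: a homomorphism of the underlying supported
actions preserving all left compatible joins. -/
def IsModHom {S X Y : Type*} [Pseudogroup S] (M : SMod S X) (N : SMod S Y) (θ : X → Y) : Prop :=
  SupportedAction.IsActHom M.toSupportedAction N.toSupportedAction θ ∧
  ∀ (A : Set X) (j : X), M.toSupportedAction.LCompatSet A → M.toSupportedAction.IsJoinX A j →
    N.toSupportedAction.IsJoinX (θ '' A) (θ j)

/-- `L(X)`: the set of left compatible order-ideals of a supported action `X`. -/
abbrev LIdeal {S : Type*} [InverseSemigroup S] {X : Type*} (M : SupportedAction S X) : Type _ :=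
  {A : Set X // (∀ x y : X, M.xle x y → y ∈ A → x ∈ A) ∧ M.LCompatSet A}

/-- An `(S,T)`-biaction with inner products. -/
structure Biaction (S T : Type*) [InverseSemigroup S] [InverseSemigroup T] (X : Type*) where
  actL : S → X → X
  actL_mul : ∀ (s t : S) (x : X), actL (s * t) x = actL s (actL t x)
  actR : X → T → X
  actR_mul : ∀ (x : X) (t u : T), actR x (t * u) = actR (actR x t) u
  actLR : ∀ (s : S) (x : X) (t : T), actR (actL s x) t = actL s (actR x t)
  ip : X → X → S
  iq : X → X → T
  ip_actL : ∀ (s : S) (x y : X), ip (actL s x) y = s * ip x y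
  ip_symm : ∀ x y : X, ip y x = (ip x y)⁻¹
  ip_self_act : ∀ x : X, actL (ip x x) x = x
  iq_actR : ∀ (x y : X) (t : T), iq x (actR y t) = iq x y * t
  iq_symm : ∀ x y : X, iq y x = (iq x y)⁻¹
  iq_self_act : ∀ x : X, actR x (iq x x) = x
  ip_iq_assoc : ∀ x y z : X, actL (ip x y) z = actR x (iq y z)

namespace Biaction

variable {S T : Type*} [InverseSemigroup S] [InverseSemigroup T] {X : Type*}

/-- Left compatibility in a biaction: `p(x) y = p(y) x` with `p x = ⟨x,x⟩`. -/
def LCompatX (B : Biaction S T X) (x y : X) : Prop :=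
  B.actL (B.ip x x) y = B.actL (B.ip y y) x

/-- Right compatibility in a biaction: `x q(y) = y q(x)` with `q x = [x,x]`. -/
def RCompatX (B : Biaction S T X) (x y : X) : Prop :=
  B.actR x (B.iq y y) = B.actR y (B.iq x x)

/-- Compatibility in a biaction. -/
def CompatX (B : Biaction S T X) (x y : X) : Prop := B.LCompatX x y ∧ B.RCompatX x y

/-- A compatible subset of `X`. -/
def CompatSetX (B : Biaction S T X) (A : Set X) : Prop := ∀ x ∈ A, ∀ y ∈ A, B.CompatX x y

/-- The order on `X`: `x ≤ y` iff `x = e • y` for some idempotent `e ∈ S`. -/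
def bxle (B : Biaction S T X) (x y : X) : Prop := ∃ e : S, IsIdem e ∧ x = B.actL e y

/-- `j` is the join of `A ⊆ X`. -/
def IsJoinBX (B : Biaction S T X) (A : Set X) (j : X) : Prop :=
  (∀ a ∈ A, B.bxle a j) ∧ ∀ b : X, (∀ a ∈ A, B.bxle a b) → B.bxle j b

end Biaction

/-- An `(S,T)`-bimodule over pseudogroups `S` and `T`. -/
structure Bimodule (S T : Type*) [Pseudogroup S] [Pseudogroup T] (X : Type*) extends
    Biaction S T X where
  joinsX : ∀ A : Set X, toBiaction.CompatSetX A → ∃ j : X, toBiaction.IsJoinBX A j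
  distL : ∀ (s : S) (A : Set X) (j : X), toBiaction.CompatSetX A → toBiaction.IsJoinBX A j →
    toBiaction.IsJoinBX (toBiaction.actL s '' A) (toBiaction.actL s j)
  distSL : ∀ (A : Set S) (j : S), CompatSet A → IsJoin A j → ∀ x : X,
    toBiaction.IsJoinBX ((fun s => toBiaction.actL s x) '' A) (toBiaction.actL j x)
  distR : ∀ (t : T) (A : Set X) (j : X), toBiaction.CompatSetX A → toBiaction.IsJoinBX A j →
    toBiaction.IsJoinBX ((fun x => toBiaction.actR x t) '' A) (toBiaction.actR j t)
  distTR : ∀ (A : Set T) (j : T), CompatSet A → IsJoin A j → ∀ x : X,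
    toBiaction.IsJoinBX ((fun t => toBiaction.actR x t) '' A) (toBiaction.actR x j)
  distIP : ∀ (A : Set X) (j : X), toBiaction.CompatSetX A → toBiaction.IsJoinBX A j → ∀ y : X,
    IsJoin ((fun x => toBiaction.ip x y) '' A) (toBiaction.ip j y)
  distIQ : ∀ (A : Set X) (j : X), toBiaction.CompatSetX A → toBiaction.IsJoinBX A j → ∀ y : X,
    IsJoin ((fun x => toBiaction.iq y x) '' A) (toBiaction.iq y j)

/-- An `(S,T)`-equivalence bimodule: an `(S,T)`-bimodule satisfying both covering
conditions `⋁_{x∈X} ⟨x,x⟩ = e_S` and `⋁_{x∈X} [x,x] = e_T`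
(where `e_S = ⋁ E(S)` and `e_T = ⋁ E(T)`). -/
structure EquivBimodule (S T : Type*) [Pseudogroup S] [Pseudogroup T] (X : Type*) extends
    Bimodule S T X where
  coverS : ∀ jS : S, IsJoin {e : S | IsIdem e} jS →
    IsJoin (Set.range fun x : X => toBimodule.toBiaction.ip x x) jS
  coverT : ∀ jT : T, IsJoin {e : T | IsIdem e} jT →
    IsJoin (Set.range fun x : X => toBimodule.toBiaction.iq x x) jT


/-- `U` (with distinguished idempotents `eU`, `fU`) is a joint sup-enlargement of the
pseudogroups `S` and `T`: `eU U eU ≅ S`, `fU U fU ≅ T`, and the sup-enlargement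
conditions (E1) and (E2) hold for both local pseudogroups. -/
def JointEnlargementWitness (U S T : Type*) [Pseudogroup U] [Pseudogroup S] [Pseudogroup T]
    (eU fU : U) : Prop :=
  IsIdem eU ∧ IsIdem fU ∧
  locSet eU = tripleProd (locSet eU) Set.univ (locSet eU) ∧
  locSet fU = tripleProd (locSet fU) Set.univ (locSet fU) ∧
  (Set.univ : Set U) = supClosure (tripleProd Set.univ (locSet eU) Set.univ) ∧
  (Set.univ : Set U) = supClosure (tripleProd Set.univ (locSet fU) Set.univ) ∧
  (∃ φ : S → U, Function.Injective φ ∧ Set.range φ = locSet eU ∧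
    ∀ a b : S, φ (a * b) = φ a * φ b) ∧
  (∃ ψ : T → U, Function.Injective ψ ∧ Set.range ψ = locSet fU ∧
    ∀ a b : T, ψ (a * b) = ψ a * ψ b)

section InvBasics

variable {S : Type*}

theorem inv_unique_of_comm [Semigroup S] (hc : ∀ e f : S, IsIdem e → IsIdem f → e * f = f * e)
    (a b c : S) (h1 : a * b * a = a) (h2 : b * a * b = b) (h3 : a * c * a = a)
    (h4 : c * a * c = c) : b = c := by
  have i1 : IsIdem (a * b) := by unfold IsIdem; rw [← mul_assoc, h1]
  have i2 : IsIdem (a * c) := by unfold IsIdem; rw [← mul_assoc, h3]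
  have i3 : IsIdem (b * a) := by unfold IsIdem; rw [← mul_assoc, h2]
  have i4 : IsIdem (c * a) := by unfold IsIdem; rw [← mul_assoc, h4]
  calc b = b * a * b := h2.symm
    _ = b * (a * c * a) * b := by rw [h3]
    _ = b * ((a * c) * (a * b)) := by simp only [mul_assoc]
    _ = b * ((a * b) * (a * c)) := by rw [hc _ _ i2 i1]
    _ = b * (a * b * a) * c := by simp only [mul_assoc]
    _ = (b * a) * (c * a * c) := by rw [h1, h4]
    _ = ((b * a) * (c * a)) * c := by simp only [mul_assoc]
    _ = ((c * a) * (b * a)) * c := by rw [hc _ _ i3 i4]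
    _ = c * (a * b * a) * c := by simp only [mul_assoc]
    _ = c := by rw [h1, h4]

variable [InverseSemigroup S]

theorem iinv_inv (a : S) : a⁻¹⁻¹ = a :=
  (InverseSemigroup.inv_unique a⁻¹ a (InverseSemigroup.inv_mul_inv a)
    (InverseSemigroup.mul_inv_mul a)).symm

theorem idem_inv {e : S} (h : IsIdem e) : e⁻¹ = e := by
  unfold IsIdem at h
  exact (InverseSemigroup.inv_unique e e (by rw [h, h]) (by rw [h, h])).symm

theorem ami (a b : S) : a * (a⁻¹ * (a * b)) = a * b := by
  rw [← mul_assoc, ← mul_assoc, InverseSemigroup.mul_inv_mul]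

theorem ima (a b : S) : a⁻¹ * (a * (a⁻¹ * b)) = a⁻¹ * b := by
  rw [← mul_assoc, ← mul_assoc, InverseSemigroup.inv_mul_inv]

theorem ami' (a : S) : a * (a⁻¹ * a) = a := by
  rw [← mul_assoc, InverseSemigroup.mul_inv_mul]

theorem ima' (a : S) : a⁻¹ * (a * a⁻¹) = a⁻¹ := by
  rw [← mul_assoc, InverseSemigroup.inv_mul_inv]

theorem IsIdem.l {e : S} (h : IsIdem e) (b : S) : e * (e * b) = e * b := by
  rw [← mul_assoc, h]

theorem idem_mul {e f : S} (he : IsIdem e) (hf : IsIdem f) : IsIdem (e * f) := by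
  have k1 : (e * f) * (e * f)⁻¹ * (e * f) = e * f := InverseSemigroup.mul_inv_mul _
  have k2 : (e * f)⁻¹ * (e * f) * (e * f)⁻¹ = (e * f)⁻¹ := InverseSemigroup.inv_mul_inv _
  have k2' : ∀ c, (e * f)⁻¹ * (e * (f * ((e * f)⁻¹ * c))) = (e * f)⁻¹ * c := by
    intro c
    conv_rhs => rw [← k2]
    simp only [mul_assoc]
  have hb : f * (e * f)⁻¹ * e = (e * f)⁻¹ := by
    apply InverseSemigroup.inv_unique
    · rw [← k1]
      conv_rhs => rw [← k1]
      simp only [mul_assoc] at *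
      simp only [he.l, hf.l, k1]
    · simp only [mul_assoc, he.l, hf.l, k2']
  have hi : IsIdem ((e * f)⁻¹) := by
    unfold IsIdem
    conv_lhs => rw [← hb]
    conv_rhs => rw [← hb]
    simp only [mul_assoc, k2']
  have : e * f = (e * f)⁻¹ := by
    conv_lhs => rw [← iinv_inv (e * f), idem_inv hi]
  rw [this]; exact hi

theorem idem_comm {e f : S} (he : IsIdem e) (hf : IsIdem f) : e * f = f * e := by
  have h1 := idem_mul he hf
  have h2 := idem_mul hf he
  have : f * e = (e * f)⁻¹ := by
    apply InverseSemigroup.inv_unique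
    · have := h1
      unfold IsIdem at this
      simp only [mul_assoc, he.l, hf.l] at *
      exact this
    · have := h2
      unfold IsIdem at this
      simp only [mul_assoc, he.l, hf.l] at *
      exact this
  rw [this, idem_inv h1]

theorem idem_mi (a : S) : IsIdem (a * a⁻¹) := by
  unfold IsIdem; rw [← mul_assoc, InverseSemigroup.mul_inv_mul]

theorem idem_im (a : S) : IsIdem (a⁻¹ * a) := by
  unfold IsIdem; rw [← mul_assoc, InverseSemigroup.inv_mul_inv]

theorem imul_inv_rev (a b : S) : (a * b)⁻¹ = b⁻¹ * a⁻¹ := by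
  symm
  have h := idem_comm (idem_im a) (idem_mi b)
  apply InverseSemigroup.inv_unique
  · calc a * b * (b⁻¹ * a⁻¹) * (a * b) = a * ((b * b⁻¹) * (a⁻¹ * a)) * b := by
          simp only [mul_assoc]
      _ = a * b := by rw [← h]; simp only [mul_assoc, ami, ami']
  · calc b⁻¹ * a⁻¹ * (a * b) * (b⁻¹ * a⁻¹) = b⁻¹ * ((a⁻¹ * a) * (b * b⁻¹)) * a⁻¹ := by
          simp only [mul_assoc]
      _ = b⁻¹ * a⁻¹ := by rw [h]; simp only [mul_assoc, ima, ima']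

theorem idem_conj {e : S} (he : IsIdem e) (a : S) : IsIdem (a * e * a⁻¹) := by
  unfold IsIdem
  calc a * e * a⁻¹ * (a * e * a⁻¹) = a * (e * (a⁻¹ * a)) * (e * a⁻¹) := by simp only [mul_assoc]
    _ = a * e * a⁻¹ := by
      rw [idem_comm he (idem_im a)]; simp only [mul_assoc, ami, he.l]

theorem idem_conj' {e : S} (he : IsIdem e) (a : S) : IsIdem (a⁻¹ * e * a) := by
  have := idem_conj he a⁻¹; rwa [iinv_inv] at this

/-- moving an idempotent to the other side -/
theorem mul_idem_swap {e : S} (he : IsIdem e) (a : S) : a * e = (a * e * a⁻¹) * a := by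
  calc a * e = a * ((a⁻¹ * a) * e) := by simp only [mul_assoc, ami]
    _ = a * (e * (a⁻¹ * a)) := by rw [idem_comm (idem_im a) he]
    _ = _ := by simp only [mul_assoc]

theorem idem_mul_swap {e : S} (he : IsIdem e) (a : S) : e * a = a * (a⁻¹ * e * a) := by
  calc e * a = (e * (a * a⁻¹)) * a := by simp only [mul_assoc, ami']
    _ = ((a * a⁻¹) * e) * a := by rw [idem_comm (idem_mi a) he]
    _ = _ := by simp only [mul_assoc]

theorem nle_refl (a : S) : nle a a := ⟨a * a⁻¹, idem_mi a, (InverseSemigroup.mul_inv_mul a).symm⟩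

theorem nle_of_right {a b f : S} (hf : IsIdem f) (h : a = b * f) : nle a b :=
  ⟨_, idem_conj hf b, h.trans (mul_idem_swap hf b)⟩

theorem nle_right {a b : S} (h : nle a b) : ∃ f, IsIdem f ∧ a = b * f := by
  obtain ⟨e, he, rfl⟩ := h
  exact ⟨_, idem_conj' he b, idem_mul_swap he b⟩

theorem nle_trans {a b c : S} (h : nle a b) (h' : nle b c) : nle a c := by
  obtain ⟨e, he, rfl⟩ := h
  obtain ⟨f, hf, rfl⟩ := h'
  exact ⟨e * f, idem_mul he hf, (mul_assoc _ _ _).symm⟩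

theorem nle_eq {a b : S} (h : nle a b) : a = a * a⁻¹ * b := by
  obtain ⟨e, he, rfl⟩ := h
  rw [imul_inv_rev, idem_inv he]
  calc e * b = e * e * b := by rw [he]
    _ = e * (e * (b * b⁻¹)) * b := by simp only [mul_assoc, ami']
    _ = e * ((b * b⁻¹) * e) * b := by rw [idem_comm he (idem_mi b)]
    _ = _ := by simp only [mul_assoc]

theorem nle_antisymm {a b : S} (h : nle a b) (h' : nle b a) : a = b := by
  have h1 := nle_eq h
  have h2 := nle_eq h'
  calc a = a * a⁻¹ * b := h1
    _ = a * a⁻¹ * (b * b⁻¹ * a) := by rw [← h2]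
    _ = ((a * a⁻¹) * (b * b⁻¹)) * a := by simp only [mul_assoc]
    _ = ((b * b⁻¹) * (a * a⁻¹)) * a := by rw [idem_comm (idem_mi a) (idem_mi b)]
    _ = b * b⁻¹ * a := by simp only [mul_assoc, ami']
    _ = b := h2.symm

theorem nle_mul_left {a b : S} (c : S) (h : nle a b) : nle (c * a) (c * b) := by
  obtain ⟨f, hf, rfl⟩ := nle_right h
  exact nle_of_right hf (mul_assoc _ _ _).symm

theorem nle_mul_right {a b : S} (c : S) (h : nle a b) : nle (a * c) (b * c) := by
  obtain ⟨f, hf, rfl⟩ := h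
  exact ⟨f, hf, (mul_assoc _ _ _)⟩

theorem nle_inv {a b : S} (h : nle a b) : nle a⁻¹ b⁻¹ := by
  obtain ⟨f, hf, rfl⟩ := h
  exact nle_of_right hf (by rw [imul_inv_rev, idem_inv hf])

theorem idem_of_nle {a e : S} (he : IsIdem e) (h : nle a e) : IsIdem a := by
  obtain ⟨f, hf, rfl⟩ := h
  exact idem_mul hf he

theorem leftCompat_mul_left {a b : S} (c : S) (h : LeftCompat a b) :
    LeftCompat (c * a) (c * b) := by
  unfold LeftCompat at *
  rw [imul_inv_rev]
  refine idem_of_nle h ?_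
  have : nle (c⁻¹ * c * b) b := ⟨_, idem_im c, rfl⟩
  have := nle_mul_left a⁻¹ this
  simpa only [mul_assoc] using this

theorem rightCompat_mul_left {a b : S} (c : S) (h : RightCompat a b) :
    RightCompat (c * a) (c * b) := by
  unfold RightCompat at *
  rw [imul_inv_rev]
  have := idem_conj h c
  simpa only [mul_assoc] using this

theorem compatSet_mul_left {A : Set S} (c : S) (h : CompatSet A) :
    CompatSet ((fun a => c * a) '' A) := by
  rintro _ ⟨a, ha, rfl⟩ _ ⟨b, hb, rfl⟩
  exact ⟨leftCompat_mul_left c (h a ha b hb).1, rightCompat_mul_left c (h a ha b hb).2⟩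

theorem compatSet_inv {A : Set S} (h : CompatSet A) : CompatSet ((fun a => a⁻¹) '' A) := by
  rintro _ ⟨a, ha, rfl⟩ _ ⟨b, hb, rfl⟩
  have := h a ha b hb
  unfold Compat LeftCompat RightCompat at *
  rw [iinv_inv, iinv_inv]
  exact ⟨this.2, this.1⟩

theorem isJoin_inv {A : Set S} {j : S} (h : IsJoin A j) : IsJoin ((fun a => a⁻¹) '' A) j⁻¹ := by
  constructor
  · rintro _ ⟨a, ha, rfl⟩
    exact nle_inv (h.1 a ha)
  · intro b hb
    rw [← iinv_inv b]
    apply nle_inv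
    apply h.2
    intro a ha
    rw [← iinv_inv a]
    exact nle_inv (hb _ ⟨a, ha, rfl⟩)

theorem compatSet_idem {A : Set S} (h : ∀ a ∈ A, IsIdem a) : CompatSet A := by
  intro a ha b hb
  unfold Compat LeftCompat RightCompat
  rw [idem_inv (h a ha), idem_inv (h b hb)]
  exact ⟨idem_mul (h a ha) (h b hb), idem_mul (h a ha) (h b hb)⟩

theorem isJoin_unique {A : Set S} {i j : S} (h : IsJoin A i) (h' : IsJoin A j) : i = j :=
  nle_antisymm (h.2 _ h'.1) (h'.2 _ h.1)

end InvBasics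

section PseudoBasics

variable {S : Type*} [Pseudogroup S]

theorem exists_one (S : Type*) [Pseudogroup S] : ∃ o : S, IsJoin {e : S | IsIdem e} o ∧ IsIdem o ∧
    (∀ a : S, o * a = a) ∧ ∀ a : S, a * o = a := by
  have hc : CompatSet {e : S | IsIdem e} := compatSet_idem (fun _ h => h)
  obtain ⟨o, ho⟩ := Pseudogroup.joins_exist _ hc
  have l : ∀ a : S, o * a = a := by
    intro a
    apply nle_antisymm
    · refine (Pseudogroup.mul_join_right a _ _ hc ho).2 a ?_
      rintro _ ⟨e, he, rfl⟩
      exact ⟨e, he, rfl⟩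
    · have := nle_mul_right a (ho.1 _ (idem_mi a))
      rwa [InverseSemigroup.mul_inv_mul] at this
  have r : ∀ a : S, a * o = a := by
    intro a
    apply nle_antisymm
    · refine (Pseudogroup.mul_join_left a _ _ hc ho).2 a ?_
      rintro _ ⟨e, he, rfl⟩
      exact nle_of_right he rfl
    · have := nle_mul_left a (ho.1 _ (idem_im a))
      rwa [ami'] at this
  exact ⟨o, ho, l o, l, r⟩

theorem idem_join {A : Set S} {j : S} (h : ∀ a ∈ A, IsIdem a) (hj : IsJoin A j) : IsIdem j := by
  obtain ⟨o, ho, hi, -, -⟩ := exists_one S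
  exact idem_of_nle hi (hj.2 o (fun a ha => ho.1 a (h a ha)))

end PseudoBasics

/-- A family of closed subsets of an inverse semigroup, used to complete it. -/
structure Cov (W : Type*) [InverseSemigroup W] where
  Cl : Set W → Prop
  E : Set W
  inter : ∀ 𝒜 : Set (Set W), (∀ A ∈ 𝒜, Cl A) → Cl (⋂₀ 𝒜)
  divL : ∀ (w : W) (A : Set W), Cl A → Cl {v | w * v ∈ A}
  star : ∀ A : Set W, Cl A → Cl {v | v⁻¹ ∈ A}
  down : ∀ (A : Set W), Cl A → ∀ a b : W, a ∈ A → nle b a → b ∈ A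
  clE : Cl E
  idemE : ∀ e : W, IsIdem e → e ∈ E
  E_cases : ∀ e ∈ E, IsIdem e ∨ ∀ A, Cl A → e ∈ A

namespace Cov

variable {W : Type*} [InverseSemigroup W] (K : Cov W)

theorem divR (w : W) (A : Set W) (h : K.Cl A) : K.Cl {v | v * w ∈ A} := by
  have := K.star _ (K.divL w⁻¹ _ (K.star _ h))
  simpa only [Set.mem_ofPred_eq, imul_inv_rev, iinv_inv] using this

/-- closure -/
def cl (A : Set W) : Set W := ⋂₀ {B | K.Cl B ∧ A ⊆ B}

theorem cl_closed (A : Set W) : K.Cl (K.cl A) := K.inter _ (fun _ h => h.1)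

theorem subset_cl (A : Set W) : A ⊆ K.cl A := fun _ ha _ hB => hB.2 ha

theorem cl_min {A B : Set W} (hB : K.Cl B) (h : A ⊆ B) : K.cl A ⊆ B := fun _ ha => ha B ⟨hB, h⟩

theorem cl_mono {A B : Set W} (h : A ⊆ B) : K.cl A ⊆ K.cl B :=
  K.cl_min (K.cl_closed B) (h.trans (K.subset_cl B))

theorem E_inv {e : W} (h : e ∈ K.E) : e⁻¹ ∈ K.E := by
  rcases K.E_cases e h with h | h
  · rw [idem_inv h]; exact K.idemE _ h
  · exact h _ (K.star _ K.clE)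

theorem E_mul {A : Set W} (hA : K.Cl A) {e a : W} (he : e ∈ K.E) (ha : a ∈ A) : e * a ∈ A := by
  rcases K.E_cases e he with h | h
  · exact K.down A hA a _ ha ⟨e, h, rfl⟩
  · exact h _ (K.divR a _ hA)

theorem mul_E {A : Set W} (hA : K.Cl A) {e a : W} (he : e ∈ K.E) (ha : a ∈ A) : a * e ∈ A := by
  rcases K.E_cases e he with h | h
  · exact K.down A hA a _ ha (nle_of_right h rfl)
  · exact h _ (K.divL a _ hA)

theorem E_comm {A : Set W} (hA : K.Cl A) {e f : W} (he : e ∈ K.E) (hf : f ∈ K.E)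
    (h : e * f ∈ A) : f * e ∈ A := by
  rcases K.E_cases e he with h1 | h1
  · rcases K.E_cases f hf with h2 | h2
    · rwa [idem_comm h2 h1]
    · exact h2 _ (K.divR e _ hA)
  · exact h1 _ (K.divL f _ hA)

/-- `a` and `b` are compatible relative to `E`. -/
def C (a b : W) : Prop := a⁻¹ * b ∈ K.E ∧ a * b⁻¹ ∈ K.E

theorem C_symm {a b : W} (h : K.C a b) : K.C b a := by
  constructor
  · have := K.E_inv h.1
    rwa [imul_inv_rev, iinv_inv] at this
  · have := K.E_inv h.2
    rwa [imul_inv_rev, iinv_inv] at this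

theorem C_closed (a : W) : K.Cl {b | K.C a b} := by
  have h1 := K.divL a⁻¹ _ K.clE
  have h2 := K.star _ (K.divL a _ K.clE)
  have := K.inter {{v | a⁻¹ * v ∈ K.E}, {v | v⁻¹ ∈ {v | a * v ∈ K.E}}} (by
    rintro A (rfl | rfl)
    · exact h1
    · exact h2)
  convert this using 1
  ext b
  simp [C]

theorem cl_C {A B : Set W} (h : ∀ a ∈ A, ∀ b ∈ B, K.C a b) :
    ∀ a ∈ K.cl A, ∀ b ∈ K.cl B, K.C a b := by
  have h1 : ∀ a ∈ A, ∀ b ∈ K.cl B, K.C a b := fun a ha =>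
    K.cl_min (K.C_closed a) (h a ha)
  intro a ha b hb
  apply K.C_symm
  exact K.cl_min (K.C_closed b) (fun a ha => K.C_symm (h1 a ha b hb)) ha

theorem cl_mul (A B : Set W) :
    K.cl (Set.image2 (· * ·) (K.cl A) (K.cl B)) = K.cl (Set.image2 (· * ·) A B) := by
  apply Set.Subset.antisymm
  · apply K.cl_min (K.cl_closed _)
    have h1 : ∀ a ∈ A, ∀ b ∈ K.cl B, a * b ∈ K.cl (Set.image2 (· * ·) A B) := fun a ha =>
      K.cl_min (K.divL a _ (K.cl_closed _)) (fun b hb => K.subset_cl _ ⟨a, ha, b, hb, rfl⟩)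
    rintro _ ⟨a, ha, b, hb, rfl⟩
    exact K.cl_min (K.divR b _ (K.cl_closed _)) (fun a ha => h1 a ha b hb) ha
  · exact K.cl_mono (Set.image2_subset (K.subset_cl _) (K.subset_cl _))

theorem cl_cl (A : Set W) : K.cl (K.cl A) = K.cl A :=
  Set.Subset.antisymm (K.cl_min (K.cl_closed _) subset_rfl) (K.subset_cl _)

theorem cl_eq {A : Set W} (h : K.Cl A) : K.cl A = A :=
  Set.Subset.antisymm (K.cl_min h subset_rfl) (K.subset_cl _)

/-- The completion. -/
def U : Type _ := {A : Set W // K.Cl A ∧ ∀ a ∈ A, ∀ b ∈ A, K.C a b}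

variable {K}

theorem U.ext {A B : K.U} (h : A.1 = B.1) : A = B := Subtype.ext h

theorem prod_C {a a' b b' : W} {A B : Set W} (hA : K.Cl A) (hB : K.Cl B)
    (hA' : ∀ a ∈ A, ∀ b ∈ A, K.C a b) (hB' : ∀ a ∈ B, ∀ b ∈ B, K.C a b)
    (ha : a ∈ A) (ha' : a' ∈ A) (hb : b ∈ B) (hb' : b' ∈ B) : K.C (a * b) (a' * b') := by
  constructor
  · rw [imul_inv_rev]
    have := (hB' b hb _ (K.E_mul hB (hA' a ha a' ha').1 hb')).1
    simpa only [mul_assoc] using this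
  · rw [imul_inv_rev]
    have := (hA' _ (K.mul_E hA (hB' b hb b' hb').2 ha) a' ha').2
    simpa only [mul_assoc] using this

instance : Mul K.U := ⟨fun A B => ⟨K.cl (Set.image2 (· * ·) A.1 B.1), K.cl_closed _, by
  apply K.cl_C
  rintro _ ⟨a, ha, b, hb, rfl⟩ _ ⟨a', ha', b', hb', rfl⟩
  exact prod_C A.2.1 B.2.1 A.2.2 B.2.2 ha ha' hb hb'⟩⟩

theorem mul_val (A B : K.U) : (A * B).1 = K.cl (Set.image2 (· * ·) A.1 B.1) := rfl

theorem mem_mul {A B : K.U} {a b : W} (ha : a ∈ A.1) (hb : b ∈ B.1) : a * b ∈ (A * B).1 :=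
  K.subset_cl _ ⟨a, ha, b, hb, rfl⟩

theorem mul_sub {A B : K.U} {D : Set W} (hD : K.Cl D) (h : ∀ a ∈ A.1, ∀ b ∈ B.1, a * b ∈ D) :
    (A * B).1 ⊆ D := by
  apply K.cl_min hD
  rintro _ ⟨a, ha, b, hb, rfl⟩
  exact h a ha b hb

instance : Semigroup K.U where
  mul_assoc A B D := by
    apply U.ext
    rw [mul_val, mul_val, mul_val, mul_val]
    conv_lhs => rw [← K.cl_eq D.2.1]
    conv_rhs => rw [← K.cl_eq A.2.1]
    rw [K.cl_mul, K.cl_mul, Set.image2_assoc (fun a b c => mul_assoc a b c)]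

instance : Inv K.U := ⟨fun A => ⟨{v | v⁻¹ ∈ A.1}, K.star _ A.2.1, by
  intro a ha b hb
  have := A.2.2 _ ha _ hb
  unfold C at *
  rw [iinv_inv, iinv_inv] at this
  exact ⟨this.2, this.1⟩⟩⟩

theorem mem_inv {A : K.U} {a : W} : a ∈ (A⁻¹).1 ↔ a⁻¹ ∈ A.1 := Iff.rfl

theorem inv_mem {A : K.U} {a : W} (h : a ∈ A.1) : a⁻¹ ∈ (A⁻¹).1 := by
  rw [mem_inv, iinv_inv]; exact h

theorem U_inv_inv (A : K.U) : A⁻¹⁻¹ = A := by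
  apply U.ext; ext a; rw [mem_inv, mem_inv, iinv_inv]

theorem mi_sub (A : K.U) : (A * A⁻¹).1 ⊆ K.E :=
  mul_sub K.clE (fun a ha b hb => by
    have := (A.2.2 a ha _ hb).2
    rwa [iinv_inv] at this)

theorem im_sub (A : K.U) : (A⁻¹ * A).1 ⊆ K.E :=
  mul_sub K.clE (fun a ha b hb => by
    have := (A.2.2 _ ha _ hb).1
    rwa [iinv_inv] at this)

theorem mul_sub_right {F A : K.U} (h : F.1 ⊆ K.E) : (F * A).1 ⊆ A.1 :=
  mul_sub A.2.1 (fun _ ha _ hb => K.E_mul A.2.1 (h ha) hb)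

theorem mul_sub_left {F A : K.U} (h : F.1 ⊆ K.E) : (A * F).1 ⊆ A.1 :=
  mul_sub A.2.1 (fun _ ha _ hb => K.mul_E A.2.1 (h hb) ha)

theorem U_mul_inv_mul (A : K.U) : A * A⁻¹ * A = A := by
  apply U.ext
  apply Set.Subset.antisymm
  · exact mul_sub_right (mi_sub A)
  · intro a ha
    have := mem_mul (mem_mul ha (inv_mem ha)) ha
    rwa [InverseSemigroup.mul_inv_mul] at this

theorem U_inv_mul_inv (A : K.U) : A⁻¹ * A * A⁻¹ = A⁻¹ := by
  have := U_mul_inv_mul A⁻¹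
  rwa [U_inv_inv] at this

theorem idem_sub {F : K.U} (h : IsIdem F) : F.1 ⊆ K.E := by
  have : (F⁻¹).1 ⊆ K.E := by
    have e : F⁻¹ = (F⁻¹ * F) * (F * F⁻¹) := by
      calc F⁻¹ = F⁻¹ * F * F⁻¹ := (U_inv_mul_inv F).symm
        _ = F⁻¹ * (F * F) * F⁻¹ := by rw [h]
        _ = _ := by simp only [mul_assoc]
    rw [e]
    exact (mul_sub_right (im_sub F)).trans (mi_sub F)
  intro a ha
  have := K.E_inv (this (inv_mem ha))
  rwa [iinv_inv] at this

theorem U_comm_sub {F G : K.U} (hF : F.1 ⊆ K.E) (hG : G.1 ⊆ K.E) : (F * G).1 ⊆ (G * F).1 :=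
  mul_sub (G * F).2.1 (fun _ ha _ hb => K.E_comm (G * F).2.1 (hG hb) (hF ha) (mem_mul hb ha))

theorem sub_idem {F : K.U} (h : F.1 ⊆ K.E) : IsIdem F := by
  apply U.ext
  apply Set.Subset.antisymm
  · exact mul_sub_right h
  · intro a ha
    rcases K.E_cases a (h ha) with h1 | h1
    · have := mem_mul ha ha
      rwa [h1] at this
    · exact h1 _ (F * F).2.1

instance : InverseSemigroup K.U where
  mul_inv_mul := U_mul_inv_mul
  inv_mul_inv := U_inv_mul_inv
  inv_unique A B h1 h2 := by
    refine inv_unique_of_comm ?_ A B A⁻¹ h1 h2 (U_mul_inv_mul A) (U_inv_mul_inv A)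
    intro F G hF hG
    exact U.ext (Set.Subset.antisymm (U_comm_sub (idem_sub hF) (idem_sub hG))
      (U_comm_sub (idem_sub hG) (idem_sub hF)))

theorem nle_iff {A B : K.U} : nle A B ↔ A.1 ⊆ B.1 := by
  constructor
  · rintro ⟨F, hF, rfl⟩
    exact mul_sub_right (idem_sub hF)
  · intro h
    refine ⟨A * A⁻¹, sub_idem (mi_sub A), U.ext (Set.Subset.antisymm ?_ ?_)⟩
    · intro a ha
      have := mem_mul (mem_mul ha (inv_mem ha)) (h ha)
      rwa [InverseSemigroup.mul_inv_mul] at this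
    · rw [mul_assoc]
      refine mul_sub A.2.1 (fun a ha c hc => ?_)
      refine K.mul_E A.2.1 ?_ ha
      refine mul_sub (A := A⁻¹) (B := B) K.clE (fun a ha b hb => ?_) hc
      have := (B.2.2 _ (h ha) b hb).1
      rwa [iinv_inv] at this

theorem compat_iff {A B : K.U} : Compat A B ↔ ∀ a ∈ A.1, ∀ b ∈ B.1, K.C a b := by
  constructor
  · intro h a ha b hb
    exact ⟨idem_sub h.1 (mem_mul (inv_mem ha) hb), idem_sub h.2 (mem_mul ha (inv_mem hb))⟩
  · intro h
    refine ⟨sub_idem (mul_sub K.clE (fun a ha b hb => ?_)),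
      sub_idem (mul_sub K.clE (fun a ha b hb => ?_))⟩
    · have := (h _ ha _ hb).1
      rwa [iinv_inv] at this
    · have := (h _ ha _ hb).2
      rwa [iinv_inv] at this

/-- the join of a compatible family -/
def sup (𝒜 : Set K.U) (h : CompatSet 𝒜) : K.U :=
  ⟨K.cl {w | ∃ A ∈ 𝒜, w ∈ A.1}, K.cl_closed _, by
    apply K.cl_C
    rintro a ⟨A, hA, ha⟩ b ⟨B, hB, hb⟩
    exact compat_iff.1 (h A hA B hB) a ha b hb⟩

theorem sup_isJoin (𝒜 : Set K.U) (h : CompatSet 𝒜) : IsJoin 𝒜 (sup 𝒜 h) := by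
  constructor
  · intro A hA
    rw [nle_iff]
    exact fun a ha => K.subset_cl _ ⟨A, hA, ha⟩
  · intro B hB
    rw [nle_iff]
    apply K.cl_min B.2.1
    rintro a ⟨A, hA, ha⟩
    exact nle_iff.1 (hB A hA) ha

instance : Pseudogroup K.U where
  joins_exist 𝒜 h := ⟨_, sup_isJoin 𝒜 h⟩
  mul_join_left D 𝒜 J h hJ := by
    rw [isJoin_unique hJ (sup_isJoin 𝒜 h)]
    constructor
    · rintro _ ⟨A, hA, rfl⟩
      exact nle_mul_left D ((sup_isJoin 𝒜 h).1 A hA)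
    · intro B hB
      rw [nle_iff]
      refine mul_sub B.2.1 (fun d hd a ha => ?_)
      refine K.cl_min (K.divL d _ B.2.1) ?_ ha
      rintro a ⟨A, hA, ha⟩
      exact nle_iff.1 (hB _ ⟨A, hA, rfl⟩) (mem_mul hd ha)
  mul_join_right D 𝒜 J h hJ := by
    rw [isJoin_unique hJ (sup_isJoin 𝒜 h)]
    constructor
    · rintro _ ⟨A, hA, rfl⟩
      exact nle_mul_right D ((sup_isJoin 𝒜 h).1 A hA)
    · intro B hB
      rw [nle_iff]
      refine mul_sub B.2.1 (fun a ha d hd => ?_)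
      refine K.cl_min (K.divR d _ B.2.1) ?_ ha
      rintro a ⟨A, hA, ha⟩
      exact nle_iff.1 (hB _ ⟨A, hA, rfl⟩) (mem_mul ha hd)

variable (K)

/-- the principal elements -/
def ι (w : W) : K.U := ⟨K.cl {w}, K.cl_closed _, by
  apply K.cl_C
  rintro a rfl b rfl
  exact ⟨K.idemE _ (idem_im _), K.idemE _ (idem_mi _)⟩⟩

theorem ι_mul (v w : W) : K.ι (v * w) = K.ι v * K.ι w := by
  apply U.ext
  rw [mul_val]
  change K.cl _ = K.cl (Set.image2 _ (K.cl _) (K.cl _))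
  rw [K.cl_mul, Set.image2_singleton]

theorem mem_ι (w : W) : w ∈ (K.ι w).1 := K.subset_cl _ rfl

theorem ι_sub {w : W} {A : Set W} (hA : K.Cl A) (h : w ∈ A) : (K.ι w).1 ⊆ A :=
  K.cl_min hA (by rintro _ rfl; exact h)

theorem ι_idem {w : W} (h : IsIdem w) : IsIdem (K.ι w) := by
  unfold IsIdem at *; rw [← ι_mul, h]

/-- (E1) is automatic -/
theorem E1 {V : Type*} [Semigroup V] {e : V} (h : IsIdem e) :
    locSet e = tripleProd (locSet e) Set.univ (locSet e) := by
  unfold IsIdem at h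
  have he : e ∈ locSet e := by simp [locSet, h]
  ext u
  constructor
  · intro hu
    exact ⟨e, he, u, trivial, e, he, hu⟩
  · rintro ⟨a, ha, b, -, c, hc, rfl⟩
    have h1 : e * a = a := by rw [ha, ← mul_assoc, ← mul_assoc, h]
    have h2 : c * e = c := by rw [hc, mul_assoc, h]
    change _ = _
    rw [← mul_assoc, ← mul_assoc, h1, mul_assoc (a * b) c e, h2]

/-- (E2), elementwise -/
theorem E2 {o : W} (ho : IsIdem o)
    (h : ∀ A : K.U, ∀ D : Set W, K.Cl D → (∀ u v : W, u * o * v ∈ A.1 → u * o * v ∈ D) → A.1 ⊆ D) :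
    (Set.univ : Set K.U) = supClosure (tripleProd Set.univ (locSet (K.ι o)) Set.univ) := by
  symm
  apply Set.eq_univ_of_forall
  intro A
  refine ⟨{B | ∃ u v : W, u * o * v ∈ A.1 ∧ B = K.ι (u * o * v)}, ?_, ?_, ?_, ?_⟩
  · rintro _ ⟨u, v, -, rfl⟩
    refine ⟨K.ι u, trivial, K.ι o, ?_, K.ι v, trivial, ?_⟩
    · change K.ι o = _
      rw [K.ι_idem ho, K.ι_idem ho]
    · rw [ι_mul, ι_mul]
  · rintro _ ⟨u, v, h1, rfl⟩ _ ⟨u', v', h2, rfl⟩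
    rw [compat_iff]
    intro a ha b hb
    exact A.2.2 _ (K.ι_sub A.2.1 h1 ha) _ (K.ι_sub A.2.1 h2 hb)
  · rintro _ ⟨u, v, h1, rfl⟩
    rw [nle_iff]
    exact K.ι_sub A.2.1 h1
  · intro B hB
    rw [nle_iff]
    apply h A B.1 B.2.1
    intro u v huv
    exact nle_iff.1 (hB _ ⟨u, v, huv, rfl⟩) (K.mem_ι _)

end Cov

namespace Biaction

variable {S T X : Type*} [InverseSemigroup S] [InverseSemigroup T] (B : Biaction S T X)

theorem ip_actL2 (s : S) (x y : X) : B.ip x (B.actL s y) = B.ip x y * s⁻¹ := by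
  rw [B.ip_symm (B.actL s y) x, B.ip_actL, imul_inv_rev, ← B.ip_symm]

theorem iq_actR1 (t : T) (x y : X) : B.iq (B.actR x t) y = t⁻¹ * B.iq x y := by
  rw [B.iq_symm y (B.actR x t), B.iq_actR, imul_inv_rev, ← B.iq_symm]

theorem ip_idem (x : X) : IsIdem (B.ip x x) := by
  unfold IsIdem; rw [← B.ip_actL, B.ip_self_act]

theorem iq_idem (x : X) : IsIdem (B.iq x x) := by
  unfold IsIdem; rw [← B.iq_actR, B.iq_self_act]

theorem iq_self_mul (x y : X) : B.iq x x * B.iq x y = B.iq x y := by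
  have := B.iq_actR1 (B.iq x x) x y
  rw [B.iq_self_act, ← B.iq_symm] at this
  exact this.symm

theorem ip_mul_self (x y : X) : B.ip x y * B.ip y y = B.ip x y := by
  have := B.ip_actL2 (B.ip y y) x y
  rw [B.ip_self_act, ← B.ip_symm] at this
  exact this.symm

theorem iq_aux (s : S) (x y : X) : nle (B.iq x (B.actL s⁻¹ y)) (B.iq (B.actL s x) y) := by
  refine ⟨B.iq x x, B.iq_idem x, ?_⟩
  rw [← B.iq_actR, ← B.ip_iq_assoc, B.ip_actL2, B.actL_mul, B.ip_iq_assoc, B.iq_actR,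
    B.iq_self_mul]

theorem iq_actL (s : S) (x y : X) : B.iq (B.actL s x) y = B.iq x (B.actL s⁻¹ y) := by
  apply nle_antisymm
  · have := nle_inv (B.iq_aux s⁻¹ y x)
    rwa [iinv_inv, ← B.iq_symm, ← B.iq_symm] at this
  · exact B.iq_aux s x y

theorem ip_aux (t : T) (x y : X) : nle (B.ip (B.actR x t⁻¹) y) (B.ip x (B.actR y t)) := by
  refine nle_of_right (B.ip_idem y) ?_
  rw [← B.ip_actL, B.ip_iq_assoc, B.iq_actR1, B.actR_mul, ← B.ip_iq_assoc, B.ip_actL,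
    B.ip_mul_self]

theorem ip_actR (t : T) (x y : X) : B.ip x (B.actR y t) = B.ip (B.actR x t⁻¹) y := by
  apply nle_antisymm
  · have := nle_inv (B.ip_aux t⁻¹ y x)
    rwa [iinv_inv, ← B.ip_symm, ← B.ip_symm] at this
  · exact B.ip_aux t x y


/-- The linking inverse semigroup of a biaction, with a formal zero. -/
inductive Lk {S T X : Type u} [InverseSemigroup S] [InverseSemigroup T] (B : Biaction S T X) :
    Type u
  | z : Lk B
  | s (a : S) : Lk B
  | x (a : X) : Lk B
  | y (a : X) : Lk B
  | t (a : T) : Lk B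

namespace Lk

variable {S T X : Type u} [InverseSemigroup S] [InverseSemigroup T] {B : Biaction S T X}

/-- multiplication -/
def mul : Lk B → Lk B → Lk B
  | s a, s b => s (a * b)
  | s a, x b => x (B.actL a b)
  | x a, y b => s (B.ip a b)
  | x a, t b => x (B.actR a b)
  | y a, s b => y (B.actL b⁻¹ a)
  | y a, x b => t (B.iq a b)
  | t a, y b => y (B.actR b a⁻¹)
  | t a, t b => t (a * b)
  | _, _ => z

/-- inversion -/
def inv : Lk B → Lk B
  | z => z
  | s a => s a⁻¹
  | x a => y a
  | y a => x a
  | t a => t a⁻¹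

instance : Mul (Lk B) := ⟨mul⟩
instance : Inv (Lk B) := ⟨inv⟩

section simps
variable (a b : S) (p q : X) (c d : T) (w : Lk B)
@[simp] theorem ss : (s a * s b : Lk B) = s (a * b) := rfl
@[simp] theorem sx : (s a * x p : Lk B) = x (B.actL a p) := rfl
@[simp] theorem sy : (s a * y p : Lk B) = z := rfl
@[simp] theorem st : (s a * t c : Lk B) = z := rfl
@[simp] theorem xs : (x p * s a : Lk B) = z := rfl
@[simp] theorem xx : (x p * x q : Lk B) = z := rfl
@[simp] theorem xy : (x p * y q : Lk B) = s (B.ip p q) := rfl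
@[simp] theorem xt : (x p * t c : Lk B) = x (B.actR p c) := rfl
@[simp] theorem ys : (y p * s a : Lk B) = y (B.actL a⁻¹ p) := rfl
@[simp] theorem yx : (y p * x q : Lk B) = t (B.iq p q) := rfl
@[simp] theorem yy : (y p * y q : Lk B) = z := rfl
@[simp] theorem yt : (y p * t c : Lk B) = z := rfl
@[simp] theorem ts : (t c * s a : Lk B) = z := rfl
@[simp] theorem tx : (t c * x p : Lk B) = z := rfl
@[simp] theorem ty : (t c * y p : Lk B) = y (B.actR p c⁻¹) := rfl
@[simp] theorem tt : (t c * t d : Lk B) = t (c * d) := rfl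
@[simp] theorem zw : (z * w : Lk B) = z := by cases w <;> rfl
@[simp] theorem wz : (w * z : Lk B) = z := by cases w <;> rfl
@[simp] theorem iz : (z : Lk B)⁻¹ = z := rfl
@[simp] theorem is : (s a : Lk B)⁻¹ = s a⁻¹ := rfl
@[simp] theorem ix : (x p : Lk B)⁻¹ = y p := rfl
@[simp] theorem iy : (y p : Lk B)⁻¹ = x p := rfl
@[simp] theorem it : (t c : Lk B)⁻¹ = t c⁻¹ := rfl
end simps

instance : Semigroup (Lk B) where
  mul_assoc u v w := by
    cases u <;> cases v <;> cases w <;>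
      simp [mul_assoc, B.actL_mul, B.actR_mul, B.actLR, B.ip_actL, B.ip_actL2, B.iq_actR,
        B.iq_actR1, B.iq_actL, B.ip_actR, B.ip_iq_assoc, imul_inv_rev, iinv_inv, ← B.ip_symm,
        ← B.iq_symm]

theorem idem_cases {w : Lk B} (h : IsIdem w) :
    w = z ∨ (∃ a, IsIdem a ∧ w = s a) ∨ ∃ a, IsIdem a ∧ w = t a := by
  unfold IsIdem at *
  cases w <;> simp_all

@[simp] theorem idem_s {a : S} : IsIdem (s a : Lk B) ↔ IsIdem a := by simp [IsIdem]
@[simp] theorem idem_t {a : T} : IsIdem (t a : Lk B) ↔ IsIdem a := by simp [IsIdem]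
@[simp] theorem idem_x {a : X} : ¬ IsIdem (x a : Lk B) := by simp [IsIdem]
@[simp] theorem idem_y {a : X} : ¬ IsIdem (y a : Lk B) := by simp [IsIdem]
@[simp] theorem idem_z : IsIdem (z : Lk B) := by simp [IsIdem]

theorem reg (w : Lk B) : w * w⁻¹ * w = w := by
  cases w <;> simp [InverseSemigroup.mul_inv_mul, B.ip_self_act, ← B.iq_symm, B.iq_self_act]

theorem linv_inv (w : Lk B) : w⁻¹⁻¹ = w := by cases w <;> simp [iinv_inv]

theorem reg' (w : Lk B) : w⁻¹ * w * w⁻¹ = w⁻¹ := by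
  have := reg w⁻¹
  rwa [linv_inv] at this

instance : InverseSemigroup (Lk B) where
  mul_inv_mul := reg
  inv_mul_inv := reg'
  inv_unique a b h1 h2 := by
    refine inv_unique_of_comm ?_ a b a⁻¹ h1 h2 (reg a) (reg' a)
    intro e f he hf
    rcases idem_cases he with rfl | ⟨a, ha, rfl⟩ | ⟨a, ha, rfl⟩ <;>
    rcases idem_cases hf with rfl | ⟨b, hb, rfl⟩ | ⟨b, hb, rfl⟩ <;>
    simp
    · exact idem_comm ha hb
    · exact idem_comm ha hb

@[simp] theorem nle_s {a b : S} : nle (s a : Lk B) (s b) ↔ nle a b := by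
  constructor
  · rintro ⟨e, he, h⟩
    cases e <;> simp at h he
    exact ⟨_, he, h⟩
  · rintro ⟨e, he, rfl⟩
    exact ⟨s e, by simpa, by simp⟩

@[simp] theorem nle_t {a b : T} : nle (t a : Lk B) (t b) ↔ nle a b := by
  constructor
  · rintro ⟨e, he, h⟩
    cases e <;> simp at h he
    exact ⟨_, he, h⟩
  · rintro ⟨e, he, rfl⟩
    exact ⟨t e, by simpa, by simp⟩

@[simp] theorem nle_x {a b : X} : nle (x a : Lk B) (x b) ↔ B.bxle a b := by
  constructor
  · rintro ⟨e, he, h⟩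
    cases e <;> simp at h he
    exact ⟨_, he, h⟩
  · rintro ⟨e, he, rfl⟩
    exact ⟨s e, by simpa, by simp⟩

@[simp] theorem nle_y {a b : X} : nle (y a : Lk B) (y b) ↔ B.bxle a b := by
  rw [← nle_x (B := B)]
  exact ⟨nle_inv, nle_inv⟩

/-- elements below a given one live in the same component, or vanish -/
theorem nle_cases {w v : Lk B} (h : nle w v) : w = z ∨ (∃ a b, w = s a ∧ v = s b) ∨
    (∃ a b, w = x a ∧ v = x b) ∨ (∃ a b, w = y a ∧ v = y b) ∨ (∃ a b, w = t a ∧ v = t b) := by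
  obtain ⟨e, he, rfl⟩ := h
  rcases idem_cases he with rfl | ⟨a, ha, rfl⟩ | ⟨a, ha, rfl⟩ <;> cases v <;> simp

theorem compat_s {A : Set S} : CompatSet (s '' A : Set (Lk B)) ↔ CompatSet A := by
  simp [CompatSet, Compat, LeftCompat, RightCompat]

theorem compat_t {A : Set T} : CompatSet (t '' A : Set (Lk B)) ↔ CompatSet A := by
  simp [CompatSet, Compat, LeftCompat, RightCompat]

theorem lcompat_iff {p q : X} : B.LCompatX p q ↔ IsIdem (B.iq p q) := by
  unfold LCompatX
  rw [B.ip_iq_assoc, B.ip_iq_assoc]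
  constructor
  · intro h
    have h1 : B.iq p q = B.iq p q * B.iq q p := by
      rw [← B.iq_actR, ← h, B.iq_actR, B.iq_self_mul]
    rw [h1, B.iq_symm p q]
    exact idem_mi _
  · intro h
    have h4 : B.actL (B.ip q q) p = B.actR q (B.iq p q) := by
      rw [B.ip_iq_assoc, B.iq_symm p q, idem_inv h]
    rw [← B.ip_iq_assoc q, h4, ← B.ip_iq_assoc]
    conv_lhs => rw [← B.ip_self_act q, ← B.actL_mul, idem_comm (B.ip_idem p) (B.ip_idem q),
      B.actL_mul, B.ip_iq_assoc p, ← B.actLR, h4, ← B.actR_mul, h]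

theorem rcompat_iff {p q : X} : B.RCompatX p q ↔ IsIdem (B.ip p q) := by
  unfold RCompatX
  rw [← B.ip_iq_assoc, ← B.ip_iq_assoc]
  constructor
  · intro h
    have h1 : B.ip p q = B.ip q p * B.ip p q := by
      rw [← B.ip_actL, ← h, B.ip_actL, B.ip_mul_self]
    rw [h1, B.ip_symm q p]
    exact idem_mi _
  · intro h
    have h4 : B.actR p (B.iq q q) = B.actL (B.ip p q) q := by
      rw [B.ip_iq_assoc]
    have h5 : B.actR q (B.iq p p) = B.actL (B.ip p q) p := by
      rw [← B.ip_iq_assoc, B.ip_symm p q, idem_inv h]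
    rw [B.ip_symm p q, idem_inv h]
    have h6 : B.actR p (B.iq q q) = B.actR (B.actR p (B.iq q q)) (B.iq p p) := by
      rw [← B.actR_mul, idem_comm (B.iq_idem q) (B.iq_idem p), B.actR_mul, B.iq_self_act]
    rw [← h4, h6, h4, B.actLR, h5, ← B.actL_mul, h]

theorem compat_x {A : Set X} : CompatSet (x '' A : Set (Lk B)) ↔ B.CompatSetX A := by
  simp [CompatSet, Compat, LeftCompat, RightCompat, CompatSetX, CompatX, lcompat_iff, rcompat_iff]

theorem compat_y {A : Set X} : CompatSet (y '' A : Set (Lk B)) ↔ B.CompatSetX A := by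
  simp [CompatSet, Compat, LeftCompat, RightCompat, CompatSetX, CompatX, lcompat_iff, rcompat_iff,
    and_comm]

end Lk

end Biaction

namespace Bimodule

open Biaction Biaction.Lk

variable {S T X : Type u} [Pseudogroup S] [Pseudogroup T] (B : Bimodule S T X)

/-- closed subsets of the linking semigroup -/
structure LCl (A : Set (Lk B.toBiaction)) : Prop where
  hz : z ∈ A
  hs : ∀ (C : Set S) (j : S), CompatSet C → IsJoin C j → (∀ c ∈ C, s c ∈ A) → s j ∈ A
  hx : ∀ (C : Set X) (j : X), B.CompatSetX C → B.IsJoinBX C j → (∀ c ∈ C, x c ∈ A) → x j ∈ A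
  hy : ∀ (C : Set X) (j : X), B.CompatSetX C → B.IsJoinBX C j → (∀ c ∈ C, y c ∈ A) → y j ∈ A
  ht : ∀ (C : Set T) (j : T), CompatSet C → IsJoin C j → (∀ c ∈ C, t c ∈ A) → t j ∈ A
  down : ∀ a b : Lk B.toBiaction, a ∈ A → nle b a → b ∈ A

variable {B}

theorem LCl.divL (w : Lk B.toBiaction) {A : Set (Lk B.toBiaction)} (hA : B.LCl A) :
    B.LCl {v | w * v ∈ A} where
  hz := by simpa using hA.hz
  down a b ha hb := hA.down _ _ ha (nle_mul_left w hb)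
  hs C j hC hj h := by
    have hc := compatSet_mul_left w (compat_s (B := B.toBiaction).2 hC)
    rw [Set.image_image] at hc
    cases w with
    | s p =>
      refine hA.hs ((fun a => p * a) '' C) _ (compatSet_mul_left p hC)
        (Pseudogroup.mul_join_left p C j hC hj) ?_
      rintro _ ⟨c, hc, rfl⟩
      exact h c hc
    | y p =>
      refine hA.hy ((fun a => B.actL a⁻¹ p) '' C) _ ?_ ?_ ?_
      · rw [← compat_y, Set.image_image]; exact hc
      · have := B.distSL _ _ (compatSet_inv hC) (isJoin_inv hj) p
        rwa [Set.image_image] at this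
      · rintro _ ⟨c, hc, rfl⟩
        exact h c hc
    | _ => exact hA.hz
  hx C j hC hj h := by
    have hc := compatSet_mul_left w (compat_x (B := B.toBiaction).2 hC)
    rw [Set.image_image] at hc
    cases w with
    | s p =>
      refine hA.hx (B.actL p '' C) _ ?_ (B.distL p C j hC hj) ?_
      · rw [← compat_x, Set.image_image]; exact hc
      · rintro _ ⟨c, hc, rfl⟩
        exact h c hc
    | y p =>
      refine hA.ht ((fun a => B.iq p a) '' C) _ ?_ (B.distIQ C j hC hj p) ?_
      · rw [← compat_t (B := B.toBiaction), Set.image_image]; exact hc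
      · rintro _ ⟨c, hc, rfl⟩
        exact h c hc
    | _ => exact hA.hz
  hy C j hC hj h := by
    have hc := compatSet_mul_left w (compat_y (B := B.toBiaction).2 hC)
    rw [Set.image_image] at hc
    cases w with
    | x p =>
      refine hA.hs ((fun a => B.ip p a) '' C) _ ?_ ?_ ?_
      · rw [← compat_s (B := B.toBiaction), Set.image_image]; exact hc
      · have := isJoin_inv (B.distIP C j hC hj p)
        rw [Set.image_image, ← B.ip_symm] at this
        simpa only [← B.ip_symm] using this
      · rintro _ ⟨c, hc, rfl⟩
        exact h c hc
    | t p =>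
      refine hA.hy ((fun a => B.actR a p⁻¹) '' C) _ ?_ (B.distR p⁻¹ C j hC hj) ?_
      · rw [← compat_y, Set.image_image]; exact hc
      · rintro _ ⟨c, hc, rfl⟩
        exact h c hc
    | _ => exact hA.hz
  ht C j hC hj h := by
    have hc := compatSet_mul_left w (compat_t (B := B.toBiaction).2 hC)
    rw [Set.image_image] at hc
    cases w with
    | x p =>
      refine hA.hx ((fun a => B.actR p a) '' C) _ ?_ (B.distTR C j hC hj p) ?_
      · rw [← compat_x, Set.image_image]; exact hc
      · rintro _ ⟨c, hc, rfl⟩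
        exact h c hc
    | t p =>
      refine hA.ht ((fun a => p * a) '' C) _ (compatSet_mul_left p hC)
        (Pseudogroup.mul_join_left p C j hC hj) ?_
      rintro _ ⟨c, hc, rfl⟩
      exact h c hc
    | _ => exact hA.hz

theorem LCl.star {A : Set (Lk B.toBiaction)} (hA : B.LCl A) : B.LCl {v | v⁻¹ ∈ A} where
  hz := hA.hz
  down a b ha hb := hA.down _ _ ha (nle_inv hb)
  hs C j hC hj h := by
    refine hA.hs _ _ (compatSet_inv hC) (isJoin_inv hj) ?_
    rintro _ ⟨c, hc, rfl⟩
    exact h c hc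
  ht C j hC hj h := by
    refine hA.ht _ _ (compatSet_inv hC) (isJoin_inv hj) ?_
    rintro _ ⟨c, hc, rfl⟩
    exact h c hc
  hx C j hC hj h := hA.hy C j hC hj h
  hy C j hC hj h := hA.hx C j hC hj h

theorem LCl.inter (𝒜 : Set (Set (Lk B.toBiaction))) (h𝒜 : ∀ A ∈ 𝒜, B.LCl A) :
    B.LCl (⋂₀ 𝒜) where
  hz A hA := (h𝒜 A hA).hz
  down a b ha hb A hA := (h𝒜 A hA).down a b (ha A hA) hb
  hs C j hC hj h A hA := (h𝒜 A hA).hs C j hC hj (fun c hc => h c hc A hA)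
  hx C j hC hj h A hA := (h𝒜 A hA).hx C j hC hj (fun c hc => h c hc A hA)
  hy C j hC hj h A hA := (h𝒜 A hA).hy C j hC hj (fun c hc => h c hc A hA)
  ht C j hC hj h A hA := (h𝒜 A hA).ht C j hC hj (fun c hc => h c hc A hA)

variable (B) in
/-- idempotents together with all zeros -/
def LE : Set (Lk B.toBiaction) := {w | match w with
  | z => True
  | s a => IsIdem a
  | x a => ∀ b, B.bxle a b
  | y a => ∀ b, B.bxle a b
  | t a => IsIdem a}

theorem bxle_trans {a b c : X} (h : B.bxle a b) (h' : B.bxle b c) : B.bxle a c := by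
  rw [← nle_x] at *
  exact nle_trans h h'

theorem LE_closed : B.LCl (LE B) where
  hz := trivial
  hs C j hC hj h := idem_join (A := C) h hj
  ht C j hC hj h := idem_join (A := C) h hj
  hx C j hC hj h := fun b => hj.2 b (fun a ha => h a ha b)
  hy C j hC hj h := fun b => hj.2 b (fun a ha => h a ha b)
  down w v hw hv := by
    rcases nle_cases hv with rfl | ⟨a, b, rfl, rfl⟩ | ⟨a, b, rfl, rfl⟩ | ⟨a, b, rfl, rfl⟩ |
      ⟨a, b, rfl, rfl⟩
    · trivial
    · exact idem_of_nle (S := S) hw (nle_s.1 hv)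
    · exact fun c => bxle_trans (nle_x.1 hv) (hw c)
    · exact fun c => bxle_trans (nle_y.1 hv) (hw c)
    · exact idem_of_nle (S := T) hw (nle_t.1 hv)

variable (B) in
/-- the covering data on the linking semigroup -/
def cov : Cov (Lk B.toBiaction) where
  Cl := B.LCl
  E := LE B
  inter := LCl.inter
  divL w _ h := h.divL w
  star _ h := h.star
  down _ h := h.down
  clE := LE_closed
  idemE e he := by
    rcases idem_cases he with rfl | ⟨a, ha, rfl⟩ | ⟨a, ha, rfl⟩
    · trivial
    · exact ha
    · exact ha
  E_cases e he := by
    have hm : ∀ a, (∀ b, B.bxle a b) → B.IsJoinBX ∅ a := fun a ha =>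
      ⟨fun _ h => h.elim, fun b _ => ha b⟩
    have hc : B.CompatSetX ∅ := fun _ h => h.elim
    cases e with
    | z => exact Or.inl idem_z
    | s a => exact Or.inl (idem_s.2 he)
    | t a => exact Or.inl (idem_t.2 he)
    | x a => exact Or.inr fun A hA => hA.hx ∅ a hc (hm a he) (fun _ h => h.elim)
    | y a => exact Or.inr fun A hA => hA.hy ∅ a hc (hm a he) (fun _ h => h.elim)

theorem belowS_closed (a : S) :
    B.LCl {w | ∀ b, w = s b → nle b a} where
  hz := by simp
  hs C j hC hj h := by
    rintro b ⟨⟩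
    exact hj.2 a (fun c hc => h c hc c rfl)
  hx := by simp
  hy := by simp
  ht := by simp
  down w v hw hv := by
    rintro b rfl
    rcases nle_cases hv with h | ⟨a, b, h, rfl⟩ | ⟨a, b, h, rfl⟩ | ⟨a, b, h, rfl⟩ |
      ⟨a, b, h, rfl⟩ <;> cases h
    exact nle_trans (nle_s.1 hv) (hw _ rfl)

theorem belowT_closed (a : T) :
    B.LCl {w | ∀ b, w = t b → nle b a} where
  hz := by simp
  ht C j hC hj h := by
    rintro b ⟨⟩
    exact hj.2 a (fun c hc => h c hc c rfl)
  hx := by simp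
  hy := by simp
  hs := by simp
  down w v hw hv := by
    rintro b rfl
    rcases nle_cases hv with h | ⟨a, b, h, rfl⟩ | ⟨a, b, h, rfl⟩ | ⟨a, b, h, rfl⟩ |
      ⟨a, b, h, rfl⟩ <;> cases h
    exact nle_trans (nle_t.1 hv) (hw _ rfl)

theorem inj_s {a b : S} (h : (B.cov.ι (s a)).1 ⊆ (B.cov.ι (s b)).1) : nle a b :=
  B.cov.ι_sub (belowS_closed b) (by rintro c ⟨⟩; exact nle_refl _) (h (B.cov.mem_ι _)) a rfl

theorem inj_t {a b : T} (h : (B.cov.ι (t a)).1 ⊆ (B.cov.ι (t b)).1) : nle a b :=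
  B.cov.ι_sub (belowT_closed b) (by rintro c ⟨⟩; exact nle_refl _) (h (B.cov.mem_ι _)) a rfl

theorem range_s {o : S} (hl : ∀ a : S, o * a = a) (hr : ∀ a : S, a * o = a) :
    Set.range (fun a : S => B.cov.ι (s a)) = locSet (B.cov.ι (s o)) := by
  ext A
  constructor
  · rintro ⟨a, rfl⟩
    change _ = _
    rw [← Cov.ι_mul, ← Cov.ι_mul, ss, ss, hl, hr]
  · intro hA
    change A = _ at hA
    have hC : CompatSet {a : S | s a ∈ A.1} := fun a ha b hb => A.2.2 _ ha _ hb
    obtain ⟨j, hj⟩ := Pseudogroup.joins_exist _ hC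
    have hjA : s j ∈ A.1 := A.2.1.hs _ j hC hj (fun _ h => h)
    refine ⟨j, Cov.U.ext (Set.Subset.antisymm (B.cov.ι_sub A.2.1 hjA) ?_)⟩
    rw [hA, mul_assoc]
    have hcl := (B.cov.ι (s j)).2.1
    refine Cov.mul_sub hcl fun a ha c hc => ?_
    refine B.cov.ι_sub (B.cov.divR c _ hcl) ?_ ha
    refine Cov.mul_sub (B.cov.divL (s o) _ hcl) (fun v hv d hd => ?_) hc
    refine B.cov.ι_sub (B.cov.divL v _ (B.cov.divL (s o) _ hcl)) ?_ hd
    change s o * (v * s o) ∈ (B.cov.ι (s j)).1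
    cases v with
    | s p =>
      simp only [ss, hl, hr]
      exact hcl.down _ _ (B.cov.mem_ι _) (nle_s.2 (hj.1 p hv))
    | _ => simpa using hcl.hz

theorem range_t {o : T} (hl : ∀ a : T, o * a = a) (hr : ∀ a : T, a * o = a) :
    Set.range (fun a : T => B.cov.ι (t a)) = locSet (B.cov.ι (t o)) := by
  ext A
  constructor
  · rintro ⟨a, rfl⟩
    change _ = _
    rw [← Cov.ι_mul, ← Cov.ι_mul, tt, tt, hl, hr]
  · intro hA
    change A = _ at hA
    have hC : CompatSet {a : T | t a ∈ A.1} := fun a ha b hb => A.2.2 _ ha _ hb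
    obtain ⟨j, hj⟩ := Pseudogroup.joins_exist _ hC
    have hjA : t j ∈ A.1 := A.2.1.ht _ j hC hj (fun _ h => h)
    refine ⟨j, Cov.U.ext (Set.Subset.antisymm (B.cov.ι_sub A.2.1 hjA) ?_)⟩
    rw [hA, mul_assoc]
    have hcl := (B.cov.ι (t j)).2.1
    refine Cov.mul_sub hcl fun a ha c hc => ?_
    refine B.cov.ι_sub (B.cov.divR c _ hcl) ?_ ha
    refine Cov.mul_sub (B.cov.divL (t o) _ hcl) (fun v hv d hd => ?_) hc
    refine B.cov.ι_sub (B.cov.divL v _ (B.cov.divL (t o) _ hcl)) ?_ hd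
    change t o * (v * t o) ∈ (B.cov.ι (t j)).1
    cases v with
    | t p =>
      simp only [tt, hl, hr]
      exact hcl.down _ _ (B.cov.mem_ι _) (nle_t.2 (hj.1 p hv))
    | _ => simpa using hcl.hz

theorem one_actL {o : S} (hl : ∀ a : S, o * a = a) (p : X) : B.actL o p = p := by
  conv_lhs => rw [← B.ip_self_act p, ← B.actL_mul, hl, B.ip_self_act]

theorem actR_one {o : T} (hr : ∀ a : T, a * o = a) (p : X) : B.actR p o = p := by
  conv_lhs => rw [← B.iq_self_act p, ← B.actR_mul, hr, B.iq_self_act]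

end Bimodule

namespace EquivBimodule

open Biaction Biaction.Lk

variable {S T X : Type u} [Pseudogroup S] [Pseudogroup T] (B : EquivBimodule S T X)

theorem e2S {o : S} (ho : IsIdem o) (hl : ∀ a : S, o * a = a) (hr : ∀ a : S, a * o = a)
    (A : B.cov.U) (D : Set (Lk B.toBiaction)) (hD : B.LCl D)
    (h : ∀ u v, u * s o * v ∈ A.1 → u * s o * v ∈ D) : A.1 ⊆ D := by
  intro w hw
  cases w with
  | z => exact hD.hz
  | s a =>
    have := h (s o) (s a)
    simp only [ss, hl] at this
    exact this hw
  | x a =>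
    have := h (s o) (x a)
    simp only [ss, sx, hl, Bimodule.one_actL hl] at this
    exact this hw
  | y a =>
    have := h (y a) (s o)
    simp only [ys, idem_inv ho, Bimodule.one_actL hl] at this
    exact this hw
  | t a =>
    obtain ⟨i, hi, -, il, ir⟩ := exists_one T
    have hc : CompatSet (Set.range fun p : X => B.iq p p) :=
      compatSet_idem (by rintro _ ⟨p, rfl⟩; exact B.iq_idem p)
    have hj := Pseudogroup.mul_join_right a _ _ hc (B.coverT i hi)
    rw [il] at hj
    refine hD.ht _ a ?_ hj ?_
    · rintro _ ⟨_, ⟨p, rfl⟩, rfl⟩ _ ⟨_, ⟨q, rfl⟩, rfl⟩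
      have h1 : nle (B.iq p p * a) a := ⟨_, B.iq_idem p, rfl⟩
      have h2 : nle (B.iq q q * a) a := ⟨_, B.iq_idem q, rfl⟩
      exact ⟨idem_of_nle (idem_im a) (nle_trans (nle_mul_left _ h2) (nle_mul_right _ (nle_inv h1))),
        idem_of_nle (idem_mi a)
          (nle_trans (nle_mul_left _ (nle_inv h2)) (nle_mul_right _ h1))⟩
    · rintro _ ⟨_, ⟨p, rfl⟩, rfl⟩
      have h1 := h (y p) (x p * t a)
      simp only [ys, xt, yx, idem_inv ho, Bimodule.one_actL hl, B.iq_actR] at h1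
      exact h1 (A.2.1.down _ _ hw (nle_t.2 ⟨_, B.iq_idem p, rfl⟩))

theorem e2T {o : T} (ho : IsIdem o) (hl : ∀ a : T, o * a = a) (hr : ∀ a : T, a * o = a)
    (A : B.cov.U) (D : Set (Lk B.toBiaction)) (hD : B.LCl D)
    (h : ∀ u v, u * t o * v ∈ A.1 → u * t o * v ∈ D) : A.1 ⊆ D := by
  intro w hw
  cases w with
  | z => exact hD.hz
  | t a =>
    have := h (t o) (t a)
    simp only [tt, hl] at this
    exact this hw
  | x a =>
    have := h (x a) (t o)
    simp only [xt, Bimodule.actR_one hr] at this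
    exact this hw
  | y a =>
    have := h (t o) (y a)
    simp only [tt, ty, hl, idem_inv ho, Bimodule.actR_one hr] at this
    exact this hw
  | s a =>
    obtain ⟨i, hi, -, il, ir⟩ := exists_one S
    have hc : CompatSet (Set.range fun p : X => B.ip p p) :=
      compatSet_idem (by rintro _ ⟨p, rfl⟩; exact B.ip_idem p)
    have hj := Pseudogroup.mul_join_right a _ _ hc (B.coverS i hi)
    rw [il] at hj
    refine hD.hs _ a ?_ hj ?_
    · rintro _ ⟨_, ⟨p, rfl⟩, rfl⟩ _ ⟨_, ⟨q, rfl⟩, rfl⟩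
      have h1 : nle (B.ip p p * a) a := ⟨_, B.ip_idem p, rfl⟩
      have h2 : nle (B.ip q q * a) a := ⟨_, B.ip_idem q, rfl⟩
      exact ⟨idem_of_nle (idem_im a) (nle_trans (nle_mul_left _ h2) (nle_mul_right _ (nle_inv h1))),
        idem_of_nle (idem_mi a)
          (nle_trans (nle_mul_left _ (nle_inv h2)) (nle_mul_right _ h1))⟩
    · rintro _ ⟨_, ⟨p, rfl⟩, rfl⟩
      have h1 := h (x p) (y p * s a)
      simp only [ys, xt, xy, Bimodule.actR_one hr, B.ip_actL2, iinv_inv] at h1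
      exact h1 (A.2.1.down _ _ hw (nle_s.2 ⟨_, B.ip_idem p, rfl⟩))

end EquivBimodule

/-- **Statement 13.** If there exists an `(S,T)`-equivalence bimodule, then the
pseudogroups `S` and `T` have a joint sup-enlargement `U`. -/
theorem statement13 {S T X : Type u} [Pseudogroup S] [Pseudogroup T]
    (B : EquivBimodule S T X) :
    ∃ (U : Type u) (instU : Pseudogroup U) (eU fU : U),
      @JointEnlargementWitness U S T instU _ _ eU fU := by
  obtain ⟨o, -, ho, ol, or⟩ := exists_one S
  obtain ⟨i, -, hi, il, ir⟩ := exists_one T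
  have hso : IsIdem (Biaction.Lk.s o : Biaction.Lk B.toBiaction) := Biaction.Lk.idem_s.2 ho
  have hti : IsIdem (Biaction.Lk.t i : Biaction.Lk B.toBiaction) := Biaction.Lk.idem_t.2 hi
  refine ⟨B.cov.U, inferInstance, B.cov.ι (.s o), B.cov.ι (.t i), B.cov.ι_idem hso,
    B.cov.ι_idem hti, Cov.E1 (B.cov.ι_idem hso), Cov.E1 (B.cov.ι_idem hti),
    B.cov.E2 hso (B.e2S ho ol or), B.cov.E2 hti (B.e2T hi il ir),
    ⟨fun a => B.cov.ι (.s a), ?_, Bimodule.range_s ol or, ?_⟩,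
    ⟨fun a => B.cov.ι (.t a), ?_, Bimodule.range_t il ir, ?_⟩⟩
  · intro a b h
    have h' : B.cov.ι (.s a) = B.cov.ι (.s b) := h
    exact nle_antisymm (Bimodule.inj_s (by rw [h'])) (Bimodule.inj_s (by rw [h']))
  · intro a b
    exact B.cov.ι_mul (.s a) (.s b)
  · intro a b h
    have h' : B.cov.ι (.t a) = B.cov.ι (.t b) := h
    exact nle_antisymm (Bimodule.inj_t (by rw [h'])) (Bimodule.inj_t (by rw [h']))
  · intro a b
    exact B.cov.ι_mul (.t a) (.t b)

end PseudogroupMorita
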